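/- Let α, β, ω, A be real numbers with ω ≠ 0 and let u₀(t) = A·cos(ωt). Then for all t ∈ ℝ, A·cos(ωt) − (1/ω)·∫₀ᵗ sin(ω(t−x))·u₀(x)·[α·u₀(x)·u₀''(x) + α·u₀'(x)² + βω²·u₀(x)²] dx = A·cos(ωt) + (A³/16)·sin(ωt)·[2ωt·(2α − 3β) + (2α − β)·sin(2ωt)]. That is, the first iterate of the Laplace-transform integral equation with seed u₀ is exactly u₁(t) = A·cos(ωt) + (A³/16)·sin(ωt)·[2ωt(2α − 3β) + (2α − β)·sin(2ωt)]. -/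

import Mathlib

/-- With seed `u₀(t) = A cos(ωt)`, the first iterate of the
Laplace-transform integral equation equals exactly
`u₁(t) = A cos(ωt) + (A³/16) sin(ωt)[2ωt(2α − 3β) + (2α − β) sin(2ωt)]`. -/
theorem cantilever_first_iterate (α β ω A : ℝ) (hω : ω ≠ 0) (u₀ : ℝ → ℝ)
    (hu₀ : ∀ t, u₀ t = A * Real.cos (ω * t)) :
    ∀ t : ℝ, A * Real.cos (ω * t)
      - (1 / ω) * ∫ x in (0:ℝ)..t, Real.sin (ω * (t - x)) * u₀ x
          * (α * u₀ x * deriv (deriv u₀) x + α * (deriv u₀ x) ^ 2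
              + β * ω ^ 2 * (u₀ x) ^ 2)
      = A * Real.cos (ω * t) + A ^ 3 / 16 * Real.sin (ω * t)
          * (2 * ω * t * (2 * α - 3 * β)
              + (2 * α - β) * Real.sin (2 * ω * t)) := by
  obtain rfl : u₀ = fun t => A * Real.cos (ω * t) := funext hu₀
  have hcos (x : ℝ) : HasDerivAt (fun y => Real.cos (ω * y)) (-Real.sin (ω * x) * ω) x := by
    simpa using ((hasDerivAt_id x).const_mul ω).cos
  have hsin (x : ℝ) : HasDerivAt (fun y => Real.sin (ω * y)) (Real.cos (ω * x) * ω) x := by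
    simpa using ((hasDerivAt_id x).const_mul ω).sin
  have hd1 : deriv (fun t => A * Real.cos (ω * t)) =
      fun t => A * (-Real.sin (ω * t) * ω) :=
    funext fun x => ((hcos x).const_mul A).deriv
  have hd2 : deriv (fun t => A * (-Real.sin (ω * t) * ω)) =
      fun t => A * (-(Real.cos (ω * t) * ω) * ω) :=
    funext fun x => (((hsin x).neg.mul_const ω).const_mul A).deriv
  intro t
  simp only [hd1, hd2]
  set S := Real.sin (ω * t) with hS
  set C := Real.cos (ω * t) with hC
  have hSC : S ^ 2 = 1 - C ^ 2 := Real.sin_sq _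
  have key (x : ℝ) : HasDerivAt (fun x => A ^ 3 * ω ^ 2 *
      (S * (α * (x / 2 + Real.sin (ω * x) * Real.cos (ω * x) / (2 * ω))
          + (β - 2 * α) * (3 * x / 8 + 3 * (Real.sin (ω * x) * Real.cos (ω * x)) / (8 * ω)
            + Real.sin (ω * x) * Real.cos (ω * x) ^ 3 / (4 * ω)))
        + C * (α * (Real.cos (ω * x) ^ 2 / (2 * ω))
          + (β - 2 * α) * (Real.cos (ω * x) ^ 4 / (4 * ω)))))
      (Real.sin (ω * (t - x)) * (A * Real.cos (ω * x)) *
        (α * (A * Real.cos (ω * x)) * (A * (-(Real.cos (ω * x) * ω) * ω))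
          + α * (A * (-Real.sin (ω * x) * ω)) ^ 2
          + β * ω ^ 2 * (A * Real.cos (ω * x)) ^ 2)) x := by
    have hid := hasDerivAt_id' x
    have hsc := (hsin x).mul (hcos x)
    have h := ((((hid.div_const 2).add (hsc.div_const (2 * ω))).const_mul α).add
      (((((hid.const_mul 3).div_const 8).add ((hsc.const_mul 3).div_const (8 * ω))).add
        (((hsin x).mul ((hcos x).pow 3)).div_const (4 * ω))).const_mul (β - 2 * α))).const_mul S
    have h' := (((((hcos x).pow 2).div_const (2 * ω)).const_mul α).add
      ((((hcos x).pow 4).div_const (4 * ω)).const_mul (β - 2 * α))).const_mul C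
    refine ((h.add h').const_mul (A ^ 3 * ω ^ 2)).congr_deriv ?_
    have hx : Real.sin (ω * x) ^ 2 = 1 - Real.cos (ω * x) ^ 2 := Real.sin_sq _
    rw [mul_sub, Real.sin_sub, ← hS, ← hC]
    simp only [Pi.pow_apply]
    generalize Real.sin (ω * x) = s at *
    generalize Real.cos (ω * x) = c at *
    field_simp
    push_cast
    ring_nf
    have h3 : s ^ 3 = s * (1 - c ^ 2) := by rw [← hx]; ring
    simp only [hx, h3]
    ring
  rw [intervalIntegral.integral_eq_sub_of_hasDerivAt (fun x _ => key x)
    (Continuous.intervalIntegrable (by fun_prop) _ _)]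
  rw [show 2 * ω * t = 2 * (ω * t) by ring, Real.sin_two_mul, ← hS, ← hC]
  simp only [mul_zero, Real.sin_zero, Real.cos_zero]
  field_simp
  ring_nf
  simp only [hSC]
  ring
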